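/- Let g : ℝⁿ → ℝᵐ be twice continuously differentiable on an open convex set U ⊆ ℝⁿ with ‖D²g(w)‖ ≤ H for all w ∈ U. Let w_1, …, w_E ∈ U and π ∈ Δ^{E−1}, and set W̄ = Σ_{e=1}^E π_e w_e. Then the nonlinear merging residual Δ_π := g(W̄) − Σ_{e=1}^E π_e g(w_e) satisfies ‖Δ_π‖ ≤ (H/4) Σ_{e=1}^E Σ_{e'=1}^E π_e π_{e'} ‖w_e − w_{e'}‖². In particular, the residual vanishes when all w_e coincide or when π is a one-hot vector. -/

import Mathlib

/-- Second-order Taylor estimate along a segment of an open convex set. -/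
lemma Convex.norm_sub_sub_fderivWithin_le {V W : Type*}
    [NormedAddCommGroup V] [NormedSpace ℝ V] [NormedAddCommGroup W] [NormedSpace ℝ W]
    {g : V → W} {U : Set V} (hUconv : Convex ℝ U) (hUopen : IsOpen U)
    (hg : ContDiffOn ℝ 2 g U) {H : ℝ}
    (hH : ∀ w ∈ U, ‖iteratedFDerivWithin ℝ 2 g U w‖ ≤ H)
    {x y : V} (hx : x ∈ U) (hy : y ∈ U) :
    ‖g y - g x - fderivWithin ℝ g U x (y - x)‖ ≤ H / 2 * ‖y - x‖ ^ 2 := by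
  have hU : UniqueDiffOn ℝ U := hUopen.uniqueDiffOn
  have hD : DifferentiableOn ℝ (fderivWithin ℝ g U) U :=
    (hg.fderivWithin hU (m := 1) (by norm_num)).differentiableOn (by norm_num)
  have hlip : ∀ z ∈ U, ‖fderivWithin ℝ g U z - fderivWithin ℝ g U x‖ ≤ H * ‖z - x‖ := by
    intro z hz
    refine hUconv.norm_image_sub_le_of_norm_fderivWithin_le hD (fun w hw => ?_) hx hz
    rw [← norm_iteratedFDerivWithin_one _ (hU w hw),
      norm_iteratedFDerivWithin_fderivWithin hU hw]
    exact hH w hw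
  have hmem : ∀ t ∈ Set.Icc (0 : ℝ) 1, x + t • (y - x) ∈ U := fun t ht =>
    hUconv.add_smul_sub_mem hx hy ht
  have hderiv : ∀ t ∈ Set.Icc (0 : ℝ) 1,
      HasDerivAt (fun t : ℝ => g (x + t • (y - x)) - g x - t • fderivWithin ℝ g U x (y - x))
        (fderivWithin ℝ g U (x + t • (y - x)) (y - x) - fderivWithin ℝ g U x (y - x)) t := by
    intro t ht
    have h₁ : HasFDerivAt g (fderivWithin ℝ g U (x + t • (y - x))) (x + t • (y - x)) :=
      ((hg.differentiableOn (by norm_num)) _ (hmem t ht)).hasFDerivWithinAt.hasFDerivAt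
        (hUopen.mem_nhds (hmem t ht))
    have h₂ : HasDerivAt (fun t : ℝ => x + t • (y - x)) (y - x) t := by
      simpa using ((hasDerivAt_id t).smul_const (y - x)).const_add x
    have h₃ : HasDerivAt (fun t : ℝ => t • fderivWithin ℝ g U x (y - x))
        (fderivWithin ℝ g U x (y - x)) t := by
      simpa using (hasDerivAt_id t).smul_const (fderivWithin ℝ g U x (y - x))
    exact ((h₁.comp_hasDerivAt t h₂).sub_const (g x)).sub h₃
  have hB : ∀ t : ℝ, HasDerivAt (fun t : ℝ => H / 2 * ‖y - x‖ ^ 2 * t ^ 2)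
      (H * ‖y - x‖ ^ 2 * t) t := fun t =>
    ((hasDerivAt_pow 2 t).const_mul (H / 2 * ‖y - x‖ ^ 2)).congr_deriv (by push_cast; ring)
  have key := image_norm_le_of_norm_deriv_right_le_deriv_boundary
    (fun t ht => (hderiv t ht).continuousAt.continuousWithinAt)
    (fun t ht => (hderiv t (Set.Ico_subset_Icc_self ht)).hasDerivWithinAt)
    (by simp) hB (fun t ht => by
      rw [← sub_apply]
      refine (ContinuousLinearMap.le_opNorm _ _).trans ?_
      have h := hlip _ (hmem t (Set.Ico_subset_Icc_self ht))
      rw [add_sub_cancel_left, norm_smul, Real.norm_of_nonneg ht.1] at h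
      calc _ ≤ H * (t * ‖y - x‖) * ‖y - x‖ := by gcongr
        _ = H * ‖y - x‖ ^ 2 * t := by ring)
    (Set.right_mem_Icc.2 zero_le_one)
  simpa using key

/-- The weighted variance around the mean is half the weighted pairwise dispersion. -/
lemma sum_weighted_norm_sub_mean_sq {V ι : Type*} [NormedAddCommGroup V]
    [InnerProductSpace ℝ V] [Fintype ι] (w : ι → V) (p : ι → ℝ) (hp : ∑ i, p i = 1) :
    ∑ i, ∑ j, p i * p j * ‖w i - w j‖ ^ 2
      = 2 * ∑ i, p i * ‖w i - ∑ j, p j • w j‖ ^ 2 := by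
  set v := ∑ j, p j • w j with hv
  have hzero : ∑ j, p j • (w j - v) = 0 := by
    simp [smul_sub, Finset.sum_sub_distrib, ← Finset.sum_smul, hp, ← hv]
  have hinner : ∀ i, ∑ j, p j * inner ℝ (w i - v) (w j - v) = 0 := fun i => by
    simp_rw [← inner_smul_right, ← inner_sum, hzero, inner_zero_right]
  have hrow : ∀ i, ∑ j, p i * p j * ‖w i - w j‖ ^ 2
      = p i * ‖w i - v‖ ^ 2 + p i * ∑ j, p j * ‖w j - v‖ ^ 2 := fun i => by
    calc _ = ∑ j, (p j * (p i * ‖w i - v‖ ^ 2) - 2 * p i * (p j * inner ℝ (w i - v) (w j - v))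
          + p i * (p j * ‖w j - v‖ ^ 2)) := by
          refine Finset.sum_congr rfl fun j _ => ?_
          rw [← sub_sub_sub_cancel_right (w i) (w j) v, norm_sub_sq_real]
          ring
      _ = _ := by
          rw [Finset.sum_add_distrib, Finset.sum_sub_distrib, ← Finset.sum_mul,
            ← Finset.mul_sum, ← Finset.mul_sum, hinner, hp]
          ring
  simp_rw [hrow]
  rw [Finset.sum_add_distrib, ← Finset.sum_mul, hp]
  ring

/-- Representation–capacity bound: the nonlinear merging residual
`Δ_π = g(W̄) − ∑ π_e • g(w_e)` of a `C²` map `g` with second derivative bounded by `H`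
on an open convex set is controlled by the pairwise dispersion of the expert parameters:
`‖Δ_π‖ ≤ (H/4) ∑_{e,e'} π_e π_{e'} ‖w_e − w_{e'}‖²`. -/
theorem samoe_representation_capacity_bound {n m : ℕ}
    (g : EuclideanSpace ℝ (Fin n) → EuclideanSpace ℝ (Fin m))
    (U : Set (EuclideanSpace ℝ (Fin n))) (hUopen : IsOpen U) (hUconv : Convex ℝ U)
    (hg : ContDiffOn ℝ 2 g U) (H : ℝ)
    (hH : ∀ w ∈ U, ‖iteratedFDerivWithin ℝ 2 g U w‖ ≤ H)
    (E : ℕ) (w : Fin E → EuclideanSpace ℝ (Fin n)) (hw : ∀ e, w e ∈ U)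
    (π : Fin E → ℝ) (hπ0 : ∀ e, 0 ≤ π e) (hπ1 : ∑ e, π e = 1) :
    ‖g (∑ e', π e' • w e') - ∑ e, π e • g (w e)‖
      ≤ (H / 4) * ∑ e, ∑ e', π e * π e' * ‖w e - w e'‖ ^ 2 := by
  set v := ∑ e', π e' • w e' with hv
  have hvU : v ∈ U := hUconv.sum_mem (fun e _ => hπ0 e) hπ1 (fun e _ => hw e)
  have hzero : ∑ e, π e • fderivWithin ℝ g U v (w e - v) = 0 := by
    simp_rw [← map_smul, ← map_sum]
    simp [smul_sub, Finset.sum_sub_distrib, ← Finset.sum_smul, hπ1, ← hv]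
  have hres : ∑ e, π e • g (w e) - g v
      = ∑ e, π e • (g (w e) - g v - fderivWithin ℝ g U v (w e - v)) := by
    simp_rw [smul_sub (_ : ℝ) (_ - _ : EuclideanSpace ℝ (Fin m)), Finset.sum_sub_distrib, hzero,
      smul_sub, Finset.sum_sub_distrib, ← Finset.sum_smul, hπ1, one_smul, sub_zero]
  rw [norm_sub_rev, hres, sum_weighted_norm_sub_mean_sq w π hπ1, ← hv]
  calc _ ≤ ∑ e, π e * (H / 2 * ‖w e - v‖ ^ 2) := by
        refine norm_sum_le_of_le _ fun e _ => ?_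
        rw [norm_smul, Real.norm_of_nonneg (hπ0 e)]
        exact mul_le_mul_of_nonneg_left
          (hUconv.norm_sub_sub_fderivWithin_le hUopen hg hH hvU (hw e)) (hπ0 e)
    _ = _ := by
        simp_rw [Finset.mul_sum]
        exact Finset.sum_congr rfl fun e _ => by ring
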